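/- Fix H ≥ 1 and labels c : Fin H → ℕ, and let K = min_{i} c i be the minimum label. For each permutation τ of Fin H, define a random precedence using a uniformly random permutation σ of Fin H: index i precedes index h if c i < c h, or c i = c h = K and τ i < τ h, or c i = c h ≠ K and σ i < σ h; call h blocking if some i < h precedes h, and let b_τ = E_σ[ |{h : h is blocking}| ]. Then for every permutation τ, b_τ ≤ H − Σ_{h : c h ≠ K} 𝟙{c h = min_{i ≤ h} c i} / |{i : i ≤ h ∧ c i = c h}|. -/

import Mathlib

theorem aux_count {n : ℕ} (S : Finset (Fin n)) (a : Fin n) (ha : a ∈ S) :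
    Fintype.card (Equiv.Perm (Fin n)) ≤
      S.card * (Finset.univ.filter
        (fun σ : Equiv.Perm (Fin n) => ∀ i ∈ S, σ a ≤ σ i)).card := by
  classical
  have hcov : (Finset.univ : Finset (Equiv.Perm (Fin n))) ⊆
      S.biUnion (fun b => Finset.univ.filter
        (fun σ : Equiv.Perm (Fin n) => ∀ i ∈ S, σ b ≤ σ i)) := by
    intro σ _
    obtain ⟨b, hb, hmin⟩ := Finset.exists_min_image S σ ⟨a, ha⟩
    simp only [Finset.mem_biUnion, Finset.mem_filter, Finset.mem_univ, true_and]
    exact ⟨b, hb, hmin⟩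
  refine (Finset.card_le_card hcov).trans (Finset.card_biUnion_le_card_mul _ _ _ ?_)
  intro b hb
  refine Finset.card_le_card_of_injOn (fun σ => σ * Equiv.swap a b) ?_ ?_
  · intro σ hσ
    simp only [Finset.coe_filter, Finset.mem_univ, true_and, Set.mem_setOf_eq] at hσ ⊢
    intro i hi
    simp only [Equiv.Perm.mul_apply, Equiv.swap_apply_left]
    apply hσ
    rw [Equiv.swap_apply_def]
    split_ifs <;> assumption
  · intro σ _ σ' _ h
    exact mul_right_cancel h


/-- With the setup of STATEMENT 3 (stack of height `H ≥ 1`, labels `c`, minimum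
label `K`, revealed order `τ` on the minimal-label containers, random tie-breaking `σ` among
the others), for every permutation `τ` the expected number of blocking indices `b_τ` satisfies
`b_τ ≤ H − Σ_{h : c h ≠ K} 𝟙{c h = min_{i ≤ h} c i} / |{i : i ≤ h ∧ c i = c h}|`. -/
theorem stmt_4 (H : ℕ) (hH : 0 < H) (c : Fin H → ℕ) (K : ℕ)
    (hK : K = Finset.univ.inf' ⟨⟨0, hH⟩, Finset.mem_univ _⟩ c)
    (τ : Equiv.Perm (Fin H)) :
    (∑ σ : Equiv.Perm (Fin H),
        ((Finset.univ.filter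
            (fun h : Fin H => ∃ i < h,
              c i < c h ∨ (c i = c h ∧ c h = K ∧ τ i < τ h) ∨
                (c i = c h ∧ c h ≠ K ∧ σ i < σ h))).card : ℝ)) /
      (Fintype.card (Equiv.Perm (Fin H))) ≤
    (H : ℝ) -
      ∑ h ∈ Finset.univ.filter (fun h : Fin H => c h ≠ K),
        (if c h = (Finset.Iic h).inf' ⟨h, Finset.mem_Iic.mpr le_rfl⟩ c then (1 : ℝ) else 0) /
          (((Finset.Iic h).filter (fun i => c i = c h)).card : ℝ) := by
  classical
  have hP : (0 : ℝ) < (Fintype.card (Equiv.Perm (Fin H)) : ℝ) := by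
    exact_mod_cast Fintype.card_pos
  set N : ℝ := (Fintype.card (Equiv.Perm (Fin H)) : ℝ) with hN
  let m : Fin H → ℕ := fun h => (Finset.Iic h).inf' ⟨h, Finset.mem_Iic.mpr le_rfl⟩ c
  let S : Fin H → Finset (Fin H) := fun h => (Finset.Iic h).filter (fun i => c i = c h)
  let G : Equiv.Perm (Fin H) → Fin H → Prop := fun σ h =>
    c h = m h ∧ ∀ i ∈ S h, σ h ≤ σ i
  have key : ∀ σ : Equiv.Perm (Fin H),
      ((Finset.univ.filter
            (fun h : Fin H => ∃ i < h,
              c i < c h ∨ (c i = c h ∧ c h = K ∧ τ i < τ h) ∨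
                (c i = c h ∧ c h ≠ K ∧ σ i < σ h))).card : ℝ) ≤
      (H : ℝ) - ∑ h ∈ Finset.univ.filter (fun h : Fin H => c h ≠ K),
        (if G σ h then (1 : ℝ) else 0) := by
    intro σ
    rw [Finset.sum_boole, le_sub_iff_add_le]
    norm_cast
    rw [← Finset.card_union_of_disjoint]
    · exact (Finset.card_le_univ _).trans (by simp)
    · rw [Finset.disjoint_left]
      intro h h1 h2
      simp only [Finset.mem_filter, Finset.mem_univ, true_and] at h1 h2
      obtain ⟨i, hi, hc⟩ := h1
      obtain ⟨hne, hm, hS⟩ := h2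
      have hle : c h ≤ c i := by
        rw [hm]
        exact Finset.inf'_le c (Finset.mem_Iic.mpr hi.le)
      rcases hc with hc | hc | hc
      · omega
      · exact hne hc.2.1
      · exact absurd (hS i (by simp [S, hi.le, hc.1])) (not_le.mpr hc.2.2)
  rw [div_le_iff₀ hP]
  refine (Finset.sum_le_sum (fun σ _ => key σ)).trans ?_
  rw [Finset.sum_sub_distrib, Finset.sum_comm, sub_mul, Finset.sum_mul]
  have h0 : ∑ σ : Equiv.Perm (Fin H), (H : ℝ) = H * N := by
    rw [Finset.sum_const, nsmul_eq_mul, Finset.card_univ, mul_comm]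
  rw [h0]
  refine sub_le_sub_left (Finset.sum_le_sum ?_) _
  intro h _
  by_cases hm : c h = m h
  · have hS : h ∈ S h := by simp [S]
    have hpos : (0 : ℝ) < ((S h).card : ℝ) := by
      exact_mod_cast Finset.card_pos.mpr ⟨h, hS⟩
    have hc := aux_count (S h) h hS
    have hc' : N ≤ ((S h).card : ℝ) * ((Finset.univ.filter
        (fun σ : Equiv.Perm (Fin H) => ∀ i ∈ S h, σ h ≤ σ i)).card : ℝ) := by
      rw [hN]
      exact_mod_cast hc
    rw [if_pos hm, Finset.sum_boole]
    change 1 / ((S h).card : ℝ) * N ≤ _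
    rw [one_div, inv_mul_le_iff₀ hpos]
    simpa [G, hm] using hc'
  · rw [if_neg hm]
    simp only [zero_div, zero_mul]
    exact Finset.sum_nonneg (fun σ _ => by split_ifs <;> norm_num)
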